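/- arXiv:1007.3037 — 6 statements merged into one kernel-verified Lean document; each statement's English description precedes it below -/
import Mathlib

section
/- There exists a constant C > 0 such that for every integer n ≥ 2 there is a K_4-free simple graph G on n vertices in which every set of vertices containing no triangle has cardinality at most C·n^(3/5)·(log n)^(1/5). Equivalently, the Erdős–Rogers function satisfies f_{3,4}(n) ≤ C·n^(3/5)·(log n)^(1/5) for every n ≥ 2. -/
/-- Given parallel classes `cl i : V → W` of cliques and a 3-colouring of each clique, two vertices
are adjacent when they lie in a common clique and have different colours there. -/
def cliqueColoringGraph {V I W : Type*} (cl : I → V → W) (c : V × I → Fin 3) :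
    SimpleGraph V where
  Adj x y := ∃ i, cl i x = cl i y ∧ c (x, i) ≠ c (y, i)
  symm := ⟨fun _ _ ⟨i, h, hc⟩ => ⟨i, h.symm, hc.symm⟩⟩
  loopless := ⟨fun _ ⟨_, _, h⟩ => h rfl⟩

theorem cliqueColoringGraph_cliqueFree_four {V I W : Type*} (cl : I → V → W)
    (hcl : ∀ x y z i j k, x ≠ y → x ≠ z → y ≠ z →
      cl i x = cl i y → cl j x = cl j z → cl k y = cl k z → i = j ∧ i = k)
    (c : V × I → Fin 3) : (cliqueColoringGraph cl c).CliqueFree 4 := by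
  classical
  rw [SimpleGraph.cliqueFree_iff]
  refine ⟨fun f => ?_⟩
  have hf : ∀ a b, a ≠ b → (cliqueColoringGraph cl c).Adj (f a) (f b) := fun a b h =>
    f.toHom.map_adj h
  have hxy := hf 0 1 (by decide)
  have hxz := hf 0 2 (by decide)
  have hxw := hf 0 3 (by decide)
  have hyz := hf 1 2 (by decide)
  have hyw := hf 1 3 (by decide)
  have hzw := hf 2 3 (by decide)
  generalize f 0 = x at *
  generalize f 1 = y at *
  generalize f 2 = z at *
  generalize f 3 = w at *
  have := hxy.ne
  have := hxz.ne
  have := hxw.ne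
  have := hyz.ne
  have := hyw.ne
  have := hzw.ne
  obtain ⟨i₁, h₁, c₁⟩ := hxy
  obtain ⟨i₂, h₂, c₂⟩ := hxz
  obtain ⟨i₃, h₃, c₃⟩ := hxw
  obtain ⟨i₄, h₄, c₄⟩ := hyz
  obtain ⟨i₅, h₅, c₅⟩ := hyw
  obtain ⟨i₆, h₆, c₆⟩ := hzw
  obtain ⟨rfl, rfl⟩ := hcl x y z i₁ i₂ i₄ ‹_› ‹_› ‹_› h₁ h₂ h₄
  obtain ⟨rfl, rfl⟩ := hcl x y w i₁ i₃ i₅ ‹_› ‹_› ‹_› h₁ h₃ h₅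
  obtain ⟨-, rfl⟩ := hcl x z w i₁ i₁ i₆ ‹_› ‹_› ‹_› h₂ h₃ h₆
  generalize c (x, i₁) = a at *
  generalize c (y, i₁) = b at *
  generalize c (z, i₁) = d at *
  generalize c (w, i₁) = e at *
  clear * - c₁ c₂ c₃ c₄ c₅ c₆
  omega

/-- If a vertex set is triangle-free, then each clique misses some colour on it. -/
theorem exists_missing_color {V I W : Type*} (cl : I → V → W) (c : V × I → Fin 3) (S : Finset V)
    (hS : ∀ x ∈ S, ∀ y ∈ S, ∀ z ∈ S, ¬((cliqueColoringGraph cl c).Adj x y ∧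
      (cliqueColoringGraph cl c).Adj x z ∧ (cliqueColoringGraph cl c).Adj y z)) :
    ∃ g : I × W → Fin 3, ∀ x ∈ S, ∀ i, c (x, i) ≠ g (i, cl i x) := by
  have key : ∀ p : I × W, ∃ a : Fin 3, ∀ x ∈ S, cl p.1 x = p.2 → c (x, p.1) ≠ a := by
    rintro ⟨i, w⟩
    by_contra! h
    obtain ⟨x, hx, hxw, hx0⟩ := h 0
    obtain ⟨y, hy, hyw, hy1⟩ := h 1
    obtain ⟨z, hz, hzw, hz2⟩ := h 2
    refine hS x hx y hy z hz ⟨⟨i, hxw.trans hyw.symm, ?_⟩, ⟨i, hxw.trans hzw.symm, ?_⟩,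
      ⟨i, hyw.trans hzw.symm, ?_⟩⟩ <;> simp_all
  choose g hg using key
  exact ⟨g, fun x hx i => hg (i, cl i x) x hx rfl⟩

open Classical in
theorem card_colorings_avoiding {V I W : Type*} [Fintype V] [Fintype I] (cl : I → V → W)
    (S : Finset V) (g : I × W → Fin 3) :
    (Finset.univ.filter fun c : V × I → Fin 3 => ∀ x ∈ S, ∀ i, c (x, i) ≠ g (i, cl i x)).card *
      3 ^ (S.card * Fintype.card I) =
    2 ^ (S.card * Fintype.card I) * 3 ^ (Fintype.card V * Fintype.card I) := by
  have h : (Finset.univ.filter fun c : V × I → Fin 3 => ∀ x ∈ S, ∀ i, c (x, i) ≠ g (i, cl i x)) =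
      Fintype.piFinset fun p : V × I =>
        if p.1 ∈ S then Finset.univ.erase (g (p.2, cl p.2 p.1)) else Finset.univ := by
    ext c
    simp only [Finset.mem_filter, Finset.mem_univ, true_and, Fintype.mem_piFinset, Prod.forall]
    refine forall_congr' fun x => ?_
    by_cases hx : x ∈ S <;> simp [hx]
  have h' : ∀ p : V × I,
      (if p.1 ∈ S then Finset.univ.erase (g (p.2, cl p.2 p.1)) else Finset.univ).card =
        if p.1 ∈ S then 2 else 3 := by
    intro p
    split_ifs <;> simp
  rw [h, Fintype.card_piFinset, Finset.prod_congr rfl fun p _ => h' p, Fintype.prod_prod_type]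
  have hI : ∀ x : V, (∏ _i : I, if x ∈ S then 2 else 3) =
      if x ∈ S then 2 ^ Fintype.card I else 3 ^ Fintype.card I := by
    intro x
    split_ifs <;> simp
  rw [Finset.prod_congr rfl fun x _ => hI x, Finset.prod_ite]
  simp only [Finset.prod_const, Finset.filter_univ_mem, ← Finset.compl_filter, Finset.card_compl]
  have := S.card_le_univ
  obtain ⟨k, hk⟩ := Nat.exists_eq_add_of_le this
  rw [hk, Nat.add_sub_cancel_left]
  ring

/-- A union bound over colourings: some colouring makes every `m`-set contain a triangle. -/
theorem exists_coloring_forall_card_lt {V I W : Type*} [Fintype V] [Fintype I] [Fintype W]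
    (cl : I → V → W) (m : ℕ)
    (hm : Fintype.card V ^ m * 3 ^ (Fintype.card I * Fintype.card W) *
      2 ^ (m * Fintype.card I) < 3 ^ (m * Fintype.card I)) :
    ∃ c : V × I → Fin 3, ∀ S : Finset V,
      (∀ x ∈ S, ∀ y ∈ S, ∀ z ∈ S, ¬((cliqueColoringGraph cl c).Adj x y ∧
        (cliqueColoringGraph cl c).Adj x z ∧ (cliqueColoringGraph cl c).Adj y z)) →
      S.card < m := by
  classical
  by_contra! hbad
  let A (q : Finset V × (I × W → Fin 3)) : Finset (V × I → Fin 3) :=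
    Finset.univ.filter fun c => ∀ x ∈ q.1, ∀ i, c (x, i) ≠ q.2 (i, cl i x)
  let Q : Finset (Finset V × (I × W → Fin 3)) := Finset.univ.powersetCard m ×ˢ Finset.univ
  have hcover : (Finset.univ : Finset (V × I → Fin 3)) ⊆ Q.biUnion A := by
    intro c _
    obtain ⟨S, hS, hcard⟩ := hbad c
    obtain ⟨T, hTS, rfl⟩ := Finset.exists_subset_card_eq hcard
    obtain ⟨g, hg⟩ := exists_missing_color cl c T fun x hx y hy z hz h =>
      hS x (hTS hx) y (hTS hy) z (hTS hz) h.1 h.2.1 h.2.2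
    exact Finset.mem_biUnion.2 ⟨(T, g), by simp [Q], by simpa [A] using hg⟩
  have hA : ∀ q ∈ Q, (A q).card * 3 ^ (m * Fintype.card I) =
      2 ^ (m * Fintype.card I) * 3 ^ (Fintype.card V * Fintype.card I) := by
    intro q hq
    have hq' : q.1.card = m := by simpa [Q] using hq
    simpa [hq', A] using card_colorings_avoiding cl q.1 q.2
  have hQ : Q.card ≤ Fintype.card V ^ m * 3 ^ (Fintype.card I * Fintype.card W) := by
    simp only [Q, Finset.card_product, Finset.card_powersetCard, Finset.card_univ,
      Fintype.card_fun, Fintype.card_fin, Fintype.card_prod]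
    exact Nat.mul_le_mul_right _ (Nat.choose_le_pow _ _)
  have htotal : 3 ^ (Fintype.card V * Fintype.card I) ≤ ∑ q ∈ Q, (A q).card := by
    simpa using (Finset.card_le_card hcover).trans Finset.card_biUnion_le
  have hpos : 0 < 3 ^ (Fintype.card V * Fintype.card I) := by positivity
  have := calc
    3 ^ (m * Fintype.card I) * 3 ^ (Fintype.card V * Fintype.card I)
      ≤ (∑ q ∈ Q, (A q).card) * 3 ^ (m * Fintype.card I) := by
        rw [mul_comm]; exact Nat.mul_le_mul_right _ htotal
    _ = Q.card * (2 ^ (m * Fintype.card I) * 3 ^ (Fintype.card V * Fintype.card I)) := by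
        rw [Finset.sum_mul, Finset.sum_congr rfl hA, Finset.sum_const, smul_eq_mul]
    _ ≤ (Fintype.card V ^ m * 3 ^ (Fintype.card I * Fintype.card W)) *
          (2 ^ (m * Fintype.card I) * 3 ^ (Fintype.card V * Fintype.card I)) :=
        Nat.mul_le_mul_right _ hQ
    _ = (Fintype.card V ^ m * 3 ^ (Fintype.card I * Fintype.card W) *
          2 ^ (m * Fintype.card I)) * 3 ^ (Fintype.card V * Fintype.card I) := by ring
  exact absurd (Nat.le_of_mul_le_mul_right this hpos) (not_le.2 hm)

/-- The vertex `(a, b, x, y, z)` is the affine line `t ↦ (t, x + ta, y + tb, z + t(a² - εb²))`, whose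
direction lies on an elliptic quadric; the cliques of the class `t` are the points with first
coordinate `t`. -/
def quadricPoint {F : Type*} [Field F] (ε t : F) (v : F × F × F × F × F) : F × F × F :=
  (v.2.2.1 + t * v.1, v.2.2.2.1 + t * v.2.1, v.2.2.2.2 + t * (v.1 ^ 2 - ε * v.2.1 ^ 2))

theorem sq_sub_mul_sq_eq_zero {F : Type*} [Field F] {ε : F} (hε : ¬IsSquare ε) {a b : F}
    (h : a ^ 2 - ε * b ^ 2 = 0) : a = 0 ∧ b = 0 := by
  have hb : b = 0 := by
    by_contra hb
    exact hε ⟨a / b, by field_simp; linear_combination -h⟩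
  subst hb
  exact ⟨by simpa using h, rfl⟩

theorem quadricPoint_triangle {F : Type*} [Field F] {ε : F} (hε : ¬IsSquare ε)
    (u v w : F × F × F × F × F) (i j k : F) (huv : u ≠ v) (huw : u ≠ w) (hvw : v ≠ w)
    (hi : quadricPoint ε i u = quadricPoint ε i v) (hj : quadricPoint ε j u = quadricPoint ε j w)
    (hk : quadricPoint ε k v = quadricPoint ε k w) : i = j ∧ i = k := by
  obtain ⟨a₁, b₁, x₁, y₁, z₁⟩ := u
  obtain ⟨a₂, b₂, x₂, y₂, z₂⟩ := v
  obtain ⟨a₃, b₃, x₃, y₃, z₃⟩ := w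
  simp only [quadricPoint, Prod.mk.injEq] at hi hj hk
  obtain ⟨i₁, i₂, i₃⟩ := hi
  obtain ⟨j₁, j₂, j₃⟩ := hj
  obtain ⟨k₁, k₂, k₃⟩ := hk
  have ne₁ : ¬((a₁ - a₂) ^ 2 - ε * (b₁ - b₂) ^ 2 = 0) := fun h => by
    obtain ⟨ha, hb⟩ := sq_sub_mul_sq_eq_zero hε h
    obtain rfl := sub_eq_zero.1 ha
    obtain rfl := sub_eq_zero.1 hb
    simp_all
  have ne₂ : ¬((a₂ - a₃) ^ 2 - ε * (b₂ - b₃) ^ 2 = 0) := fun h => by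
    obtain ⟨ha, hb⟩ := sq_sub_mul_sq_eq_zero hε h
    obtain rfl := sub_eq_zero.1 ha
    obtain rfl := sub_eq_zero.1 hb
    simp_all
  have ne₃ : ¬((a₁ - a₃) ^ 2 - ε * (b₁ - b₃) ^ 2 = 0) := fun h => by
    obtain ⟨ha, hb⟩ := sq_sub_mul_sq_eq_zero hε h
    obtain rfl := sub_eq_zero.1 ha
    obtain rfl := sub_eq_zero.1 hb
    simp_all
  have ha : (i - j) * (a₁ - a₂) + (k - j) * (a₂ - a₃) = 0 := by
    linear_combination i₁ - j₁ + k₁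
  have hb : (i - j) * (b₁ - b₂) + (k - j) * (b₂ - b₃) = 0 := by
    linear_combination i₂ - j₂ + k₂
  have hQ : (i - j) * ((a₁ - a₂) ^ 2 - ε * (b₁ - b₂) ^ 2) =
      (k - j) * ((a₂ - a₃) ^ 2 - ε * (b₂ - b₃) ^ 2) := by
    linear_combination i₃ - j₃ + k₃ - 2 * a₂ * ha + 2 * ε * b₂ * hb
  have hQ2 : (i - j) ^ 2 * ((a₁ - a₂) ^ 2 - ε * (b₁ - b₂) ^ 2) =
      (k - j) ^ 2 * ((a₂ - a₃) ^ 2 - ε * (b₂ - b₃) ^ 2) := by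
    linear_combination ((i - j) * (a₁ - a₂) - (k - j) * (a₂ - a₃)) * ha -
      ε * ((i - j) * (b₁ - b₂) - (k - j) * (b₂ - b₃)) * hb
  have hprod : (k - j) * ((i - j) - (k - j)) * ((a₂ - a₃) ^ 2 - ε * (b₂ - b₃) ^ 2) = 0 := by
    linear_combination hQ2 - (i - j) * hQ
  have hkj : k - j = 0 := by
    by_contra hkj
    have hik : (i - j) - (k - j) = 0 := by simpa [hkj, ne₂] using hprod
    have ha' : a₁ - a₃ = 0 := (mul_eq_zero.1 (show (k - j) * (a₁ - a₃) = 0 by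
      linear_combination ha - (a₁ - a₂) * hik)).resolve_left hkj
    have hb' : b₁ - b₃ = 0 := (mul_eq_zero.1 (show (k - j) * (b₁ - b₃) = 0 by
      linear_combination hb - (b₁ - b₂) * hik)).resolve_left hkj
    exact ne₃ (by rw [ha', hb']; ring)
  have hij : i - j = 0 := by simpa [hkj, ne₁] using hQ
  exact ⟨by linear_combination hij, by linear_combination hij - hkj⟩

theorem pow_twenty_le_two_pow {n : ℕ} (hn : 256 ≤ n) : n ^ 20 ≤ 2 ^ n := by
  induction n, hn using Nat.le_induction with
  | base => norm_num
  | succ n hn ih =>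
    have h : (256 * (n + 1)) ^ 20 ≤ (257 * n) ^ 20 := Nat.pow_le_pow_left (by omega) 20
    rw [mul_pow, mul_pow] at h
    rw [pow_succ 2 n]
    have : 257 ^ 20 ≤ 2 * 256 ^ 20 := by norm_num
    generalize (n + 1) ^ 20 = a at *
    generalize n ^ 20 = b at *
    omega

theorem exists_cliqueFree_four_prime (p : ℕ) (hp : p.Prime) (hp' : 256 ≤ p) :
    ∃ G : SimpleGraph (Fin (p ^ 5)), G.CliqueFree 4 ∧ ∀ S : Finset (Fin (p ^ 5)),
      (∀ a ∈ S, ∀ b ∈ S, ∀ c ∈ S, ¬(G.Adj a b ∧ G.Adj a c ∧ G.Adj b c)) →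
      S.card < 16 * p ^ 3 := by
  have := Fact.mk hp
  obtain ⟨ε, hε⟩ := FiniteField.exists_nonsquare (F := ZMod p) (by
    rw [ZMod.ringChar_zmod_n]; omega)
  have hV : Fintype.card (ZMod p × ZMod p × ZMod p × ZMod p × ZMod p) = p ^ 5 := by
    simp only [Fintype.card_prod, ZMod.card]; ring
  let e := (Fintype.equivFinOfCardEq hV).symm
  obtain ⟨c, hc⟩ := exists_coloring_forall_card_lt (fun t v => quadricPoint ε t (e v))
      (16 * p ^ 3) (by
    have hW : Fintype.card (ZMod p × ZMod p × ZMod p) = p ^ 3 := by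
      simp only [Fintype.card_prod, ZMod.card]; ring
    rw [hW, Fintype.card_fin, ZMod.card]
    calc (p ^ 5) ^ (16 * p ^ 3) * 3 ^ (p * p ^ 3) * 2 ^ (16 * p ^ 3 * p)
        = (p ^ 20) ^ (4 * p ^ 3) * 3 ^ (p * p ^ 3) * 2 ^ (16 * p ^ 3 * p) := by
          rw [← pow_mul, ← pow_mul]; ring_nf
      _ ≤ (2 ^ p) ^ (4 * p ^ 3) * 3 ^ (p * p ^ 3) * 2 ^ (16 * p ^ 3 * p) := by
          exact Nat.mul_le_mul_right _ (Nat.mul_le_mul_right _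
            (Nat.pow_le_pow_left (pow_twenty_le_two_pow hp') _))
      _ = (2 ^ 4 * 3 * 2 ^ 16) ^ (p ^ 4) := by
          rw [mul_pow, mul_pow, ← pow_mul, ← pow_mul, ← pow_mul]; ring_nf
      _ < (3 ^ 16) ^ (p ^ 4) := Nat.pow_lt_pow_left (by norm_num) (by positivity)
      _ = 3 ^ (16 * p ^ 3 * p) := by rw [← pow_mul]; ring_nf)
  refine ⟨_, cliqueColoringGraph_cliqueFree_four _ ?_ c, hc⟩
  intro x y z i j k hxy hxz hyz
  exact quadricPoint_triangle hε _ _ _ i j k (e.injective.ne hxy) (e.injective.ne hxz)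
    (e.injective.ne hyz)

theorem exists_prime_near_fifth_root {n : ℕ} (hn : 1 ≤ n) :
    ∃ p : ℕ, p.Prime ∧ 256 ≤ p ∧ n ≤ p ^ 5 ∧ (p : ℝ) ≤ 514 * (n : ℝ) ^ ((1 : ℝ) / 5) := by
  set r := (n : ℝ) ^ ((1 : ℝ) / 5) with hr
  have hr1 : 1 ≤ r := Real.one_le_rpow (by exact_mod_cast hn) (by norm_num)
  have hr5 : r ^ 5 = n := by
    rw [hr, ← Real.rpow_natCast, ← Real.rpow_mul (by positivity)]
    norm_num
  obtain ⟨p, hp, hlt, hle⟩ := Nat.exists_prime_lt_and_le_two_mul (256 + ⌊r⌋₊) (by omega)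
  have hfloor : (⌊r⌋₊ : ℝ) ≤ r := Nat.floor_le (by linarith)
  have hle' : (p : ℝ) ≤ 2 * (256 + ⌊r⌋₊) := by exact_mod_cast hle
  refine ⟨p, hp, by omega, ?_, by linarith⟩
  have hrp : r ≤ p := by
    have h : (⌊r⌋₊ : ℝ) + 1 ≤ p := by exact_mod_cast (by omega : ⌊r⌋₊ + 1 ≤ p)
    linarith [Nat.lt_floor_add_one r]
  have : (n : ℝ) ≤ (p : ℝ) ^ 5 := hr5 ▸ pow_le_pow_left₀ (by linarith) hrp 5
  exact_mod_cast this

theorem half_le_log_rpow {n : ℕ} (hn : 2 ≤ n) : 1 / 2 ≤ (Real.log n) ^ ((1 : ℝ) / 5) := by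
  have hlog : 1 / 2 ≤ Real.log n := by
    have := Real.log_le_log (by norm_num) (show (2 : ℝ) ≤ n by exact_mod_cast hn)
    linarith [Real.log_two_gt_d9]
  calc (1 / 2 : ℝ) = (1 / 2) ^ (1 : ℝ) := (Real.rpow_one _).symm
    _ ≤ (1 / 2) ^ ((1 : ℝ) / 5) :=
      Real.rpow_le_rpow_of_exponent_ge (by norm_num) (by norm_num) (by norm_num)
    _ ≤ _ := Real.rpow_le_rpow (by norm_num) hlog (by norm_num)

/-- Erdős–Rogers function bound: there is a constant `C > 0` such that for every `n ≥ 2`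
there is a `K₄`-free graph on `n` vertices in which every triangle-free vertex set has
cardinality at most `C · n^(3/5) · (log n)^(1/5)`. -/
theorem erdos_rogers_f34_upper_bound :
    ∃ C : ℝ, 0 < C ∧ ∀ n : ℕ, 2 ≤ n →
      ∃ G : SimpleGraph (Fin n), G.CliqueFree 4 ∧
        ∀ S : Finset (Fin n),
          (∀ a ∈ S, ∀ b ∈ S, ∀ c ∈ S, ¬(G.Adj a b ∧ G.Adj a c ∧ G.Adj b c)) →
          (S.card : ℝ) ≤ C * (n : ℝ) ^ ((3 : ℝ) / 5) * (Real.log n) ^ ((1 : ℝ) / 5) := by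
  refine ⟨32 * 514 ^ 3, by norm_num, fun n hn => ?_⟩
  obtain ⟨p, hp, hp', hnp, hpn⟩ := exists_prime_near_fifth_root (show 1 ≤ n by omega)
  obtain ⟨G, hG, hS⟩ := exists_cliqueFree_four_prime p hp hp'
  refine ⟨G.comap (Fin.castLEEmb hnp), hG.comap (SimpleGraph.Embedding.comap _ G).isContained,
    fun S hfree => ?_⟩
  have hlt := hS (S.map (Fin.castLEEmb hnp)) (by simpa using hfree)
  rw [Finset.card_map] at hlt
  have hcard : (S.card : ℝ) ≤ 16 * (p : ℝ) ^ 3 := by exact_mod_cast hlt.le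
  have hroot : ((n : ℝ) ^ ((1 : ℝ) / 5)) ^ 3 = (n : ℝ) ^ ((3 : ℝ) / 5) := by
    rw [← Real.rpow_natCast, ← Real.rpow_mul (by positivity)]
    norm_num
  calc (S.card : ℝ) ≤ 16 * (514 * (n : ℝ) ^ ((1 : ℝ) / 5)) ^ 3 := hcard.trans (by gcongr)
    _ = 32 * 514 ^ 3 * (n : ℝ) ^ ((3 : ℝ) / 5) * (1 / 2) := by rw [mul_pow, hroot]; ring
    _ ≤ _ := by gcongr; exact half_le_log_rpow hn
end

section
/- There exists a constant C > 0 such that for every integer n ≥ 2 there exists a maximal K_4-free simple graph G on n vertices whose maximum degree is at most C·n^(3/5)·(log n)^(1/5). -/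
/-- Differences of classes of vertices that may be adjacent within a common row. -/
def rowSteps : Finset (ZMod 12) := {1, 2, 4, 5, 7, 8, 10, 11}

/-- Differences of classes of vertices that may be adjacent within a common column. -/
def colSteps : Finset (ZMod 12) := {1, 3, 4, 8, 9, 11}

/-- Differences of classes of adjacent vertices occupying the same grid point. -/
def pointSteps : Finset (ZMod 12) := {4, 8}

lemma neg_mem_rowSteps : ∀ a ∈ rowSteps, -a ∈ rowSteps := by decide

lemma neg_mem_colSteps : ∀ a ∈ colSteps, -a ∈ colSteps := by decide

lemma neg_mem_pointSteps : ∀ a ∈ pointSteps, -a ∈ pointSteps := by decide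

lemma zero_notMem_rowSteps : (0 : ZMod 12) ∉ rowSteps := by decide

lemma zero_notMem_colSteps : (0 : ZMod 12) ∉ colSteps := by decide

lemma rowSteps_no_K4 : ∀ a ∈ rowSteps, ∀ b ∈ rowSteps, b - a ∈ rowSteps →
    ∀ c ∈ rowSteps, c - a ∈ rowSteps → c - b ∉ rowSteps := by decide

lemma colSteps_no_K4 : ∀ a ∈ colSteps, ∀ b ∈ colSteps, b - a ∈ colSteps →
    ∀ c ∈ colSteps, c - a ∈ colSteps → c - b ∉ colSteps := by decide

lemma exists_pointSteps_zero : ∀ d : ZMod 12, ∃ g ∈ rowSteps, g - d ∈ colSteps ∧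
    ∃ h ∈ rowSteps, h - d ∈ colSteps ∧ g - h ∈ pointSteps := by decide

lemma pointSteps_subset_rowSteps : pointSteps ⊆ rowSteps := by decide

lemma pointSteps_subset_colSteps : pointSteps ⊆ colSteps := by decide

/-- Any two classes `s`, `t` have a pair of classes joined inside a grid point, both reachable from
`s` along a row and from `t` along a column. -/
lemma exists_pointSteps (s t : ZMod 12) : ∃ g h : ZMod 12, g - s ∈ rowSteps ∧ h - s ∈ rowSteps ∧
    g - t ∈ colSteps ∧ h - t ∈ colSteps ∧ g - h ∈ pointSteps := by
  obtain ⟨g, hg, hg', h, hh, hh', hgh⟩ := exists_pointSteps_zero (t - s)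
  refine ⟨g + s, h + s, ?_, ?_, ?_, ?_, ?_⟩
  · simpa using hg
  · simpa using hh
  · convert hg' using 1; ring
  · convert hh' using 1; ring
  · simpa using hgh

/-- Vertices carry a class `c` and a grid point `(x, y)`. Adjacent vertices share a row or a column,
and the allowed differences of their classes depend on which coordinates agree. -/
def gridGraph {V : Type*} (c : V → ZMod 12) (x y : V → ℕ) : SimpleGraph V where
  Adj u v :=
    (y u = y v ∧ c u - c v ∈ rowSteps ∧ (x u = x v → c u - c v ∈ pointSteps)) ∨
    (x u = x v ∧ c u - c v ∈ colSteps ∧ (y u = y v → c u - c v ∈ pointSteps))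
  symm := by
    refine ⟨fun u v h => ?_⟩
    rw [← neg_sub (c u) (c v)]
    rcases h with ⟨h1, h2, h3⟩ | ⟨h1, h2, h3⟩
    · exact Or.inl ⟨h1.symm, neg_mem_rowSteps _ h2, fun h => neg_mem_pointSteps _ (h3 h.symm)⟩
    · exact Or.inr ⟨h1.symm, neg_mem_colSteps _ h2, fun h => neg_mem_pointSteps _ (h3 h.symm)⟩
  loopless := by
    refine ⟨fun u h => ?_⟩
    simp [zero_notMem_rowSteps, zero_notMem_colSteps] at h

section GridGraph

variable {V : Type*} {c : V → ZMod 12} {x y : V → ℕ}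

lemma gridGraph_eq_or_eq {u v : V} (h : (gridGraph c x y).Adj u v) : x u = x v ∨ y u = y v :=
  h.elim (fun h => Or.inr h.1) (fun h => Or.inl h.1)

lemma gridGraph_row {u v : V} (h : (gridGraph c x y).Adj u v) (hy : y u = y v) :
    c u - c v ∈ rowSteps :=
  h.elim (fun h => h.2.1) (fun h => pointSteps_subset_rowSteps (h.2.2 hy))

lemma gridGraph_col {u v : V} (h : (gridGraph c x y).Adj u v) (hx : x u = x v) :
    c u - c v ∈ colSteps :=
  h.elim (fun h => pointSteps_subset_colSteps (h.2.2 hx)) (fun h => h.2.1)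

lemma gridGraph_cliqueFree : (gridGraph c x y).CliqueFree 4 := by
  by_contra hK
  have f := SimpleGraph.topEmbeddingOfNotCliqueFree hK
  have adj : ∀ i j : Fin 4, i ≠ j → (gridGraph c x y).Adj (f i) (f j) := fun i j hij =>
    f.map_rel_iff.2 hij
  have h01 := adj 1 0 (by decide)
  have h02 := adj 2 0 (by decide)
  have h03 := adj 3 0 (by decide)
  have h12 := adj 2 1 (by decide)
  have h13 := adj 3 1 (by decide)
  have h23 := adj 3 2 (by decide)
  have e01 := gridGraph_eq_or_eq h01
  have e02 := gridGraph_eq_or_eq h02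
  have e03 := gridGraph_eq_or_eq h03
  have e12 := gridGraph_eq_or_eq h12
  have e13 := gridGraph_eq_or_eq h13
  have e23 := gridGraph_eq_or_eq h23
  have key : (x (f 1) = x (f 0) ∧ x (f 2) = x (f 0) ∧ x (f 3) = x (f 0)) ∨
      (y (f 1) = y (f 0) ∧ y (f 2) = y (f 0) ∧ y (f 3) = y (f 0)) := by
    omega
  rcases key with ⟨h1, h2, h3⟩ | ⟨h1, h2, h3⟩
  · refine colSteps_no_K4 _ (gridGraph_col h01 h1) _ (gridGraph_col h02 h2) ?_ _
      (gridGraph_col h03 h3) ?_ ?_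
    · simpa using gridGraph_col h12 (h2.trans h1.symm)
    · simpa using gridGraph_col h13 (h3.trans h1.symm)
    · simpa using gridGraph_col h23 (h3.trans h2.symm)
  · refine rowSteps_no_K4 _ (gridGraph_row h01 h1) _ (gridGraph_row h02 h2) ?_ _
      (gridGraph_row h03 h3) ?_ ?_
    · simpa using gridGraph_row h12 (h2.trans h1.symm)
    · simpa using gridGraph_row h13 (h3.trans h1.symm)
    · simpa using gridGraph_row h23 (h3.trans h2.symm)

/-- If every class occurs at every point of the grid spanned by the coordinates, vertices that
differ in both coordinates have two adjacent common neighbours. -/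
lemma gridGraph_exists_common_edge
    (hsurj : ∀ (g : ZMod 12) (u v : V), ∃ w, c w = g ∧ x w = x u ∧ y w = y v)
    {u v : V} (hx : x u ≠ x v) (hy : y u ≠ y v) :
    ∃ w z, (gridGraph c x y).Adj w u ∧ (gridGraph c x y).Adj w v ∧ (gridGraph c x y).Adj z u ∧
      (gridGraph c x y).Adj z v ∧ (gridGraph c x y).Adj w z := by
  obtain ⟨g, h, hg, hh, hg', hh', hgh⟩ := exists_pointSteps (c u) (c v)
  obtain ⟨w, rfl, hwx, hwy⟩ := hsurj g v u
  obtain ⟨z, rfl, hzx, hzy⟩ := hsurj h v u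
  refine ⟨w, z, Or.inl ⟨hwy, hg, fun e => ?_⟩, Or.inr ⟨hwx, hg', fun e => ?_⟩,
    Or.inl ⟨hzy, hh, fun e => ?_⟩, Or.inr ⟨hzx, hh', fun e => ?_⟩,
    Or.inl ⟨hwy.trans hzy.symm, pointSteps_subset_rowSteps hgh, fun _ => hgh⟩⟩
  · exact absurd (e.symm.trans hwx) hx
  · exact absurd (hwy.symm.trans e) hy
  · exact absurd (e.symm.trans hzx) hx
  · exact absurd (hzy.symm.trans e) hy

/-- In a `K₄`-free graph containing the grid graph, neighbours share a row or a column. -/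
lemma eq_or_eq_of_adj_of_gridGraph_le
    (hsurj : ∀ (g : ZMod 12) (u v : V), ∃ w, c w = g ∧ x w = x u ∧ y w = y v)
    {G : SimpleGraph V} (hle : gridGraph c x y ≤ G) (hG : G.CliqueFree 4) {u v : V}
    (huv : G.Adj u v) : x u = x v ∨ y u = y v := by
  classical
  by_contra! hne
  obtain ⟨w, z, h1, h2, h3, h4, h5⟩ := gridGraph_exists_common_edge hsurj hne.1 hne.2
  refine hG {w, z, u, v} ?_
  have h1 := hle h1
  have h2 := hle h2
  have h3 := hle h3
  have h4 := hle h4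
  have h5 := hle h5
  refine ((SimpleGraph.is3Clique_triple_iff.2 ⟨h3, h4, huv⟩).insert ?_)
  simp [h1, h2, h5]

end GridGraph

lemma exists_maximal_cliqueFree_ge {V : Type*} [Finite V] {k : ℕ} {G₀ : SimpleGraph V}
    (h₀ : G₀.CliqueFree k) :
    ∃ G : SimpleGraph V, G₀ ≤ G ∧ G.CliqueFree k ∧ ∀ a b : V, a ≠ b → ¬ G.Adj a b →
      ¬ (G ⊔ SimpleGraph.fromEdgeSet {s(a, b)}).CliqueFree k := by
  obtain ⟨G, hle, hG⟩ := Finite.exists_le_maximal (p := fun G : SimpleGraph V => G.CliqueFree k) h₀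
  refine ⟨G, hle, hG.1, fun a b hab hn hfree => hn ?_⟩
  refine hG.2 hfree le_sup_left (Or.inr ?_)
  simp [hab]

lemma card_filter_div_mod_eq_le (n r q a : ℕ) (hr : 0 < r) :
    (Finset.univ.filter fun i : Fin n => (i : ℕ) / r % q = a).card ≤ r * (n / (r * q) + 1) := by
  rw [← Finset.card_range r, ← Finset.card_range (n / ((Finset.range r).card * q) + 1),
    ← Finset.card_product]
  simp only [Finset.card_range]
  refine Finset.card_le_card_of_injOn (fun i => ((i : ℕ) % r, (i : ℕ) / (r * q))) ?_ ?_
  · intro i _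
    simp only [Finset.coe_product, Finset.coe_range, Set.mem_prod, Set.mem_Iio]
    exact ⟨Nat.mod_lt _ hr, Nat.lt_succ_of_le (Nat.div_le_div_right i.2.le)⟩
  · intro i hi j hj hij
    simp only [Finset.coe_filter, Finset.mem_univ, true_and, Set.mem_ofPred_eq] at hi hj
    simp only [Prod.mk.injEq, ← Nat.div_div_eq_div_mul] at hij
    ext
    rw [← Nat.div_add_mod (i : ℕ) r, ← Nat.div_add_mod (j : ℕ) r, hij.1,
      ← Nat.div_add_mod ((i : ℕ) / r) q, ← Nat.div_add_mod ((j : ℕ) / r) q, hij.2, hi, hj]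

lemma exists_maximal_K4_free_le_sqrt (n : ℕ) :
    ∃ G : SimpleGraph (Fin n), G.CliqueFree 4 ∧
      (∀ a b : Fin n, a ≠ b → ¬ G.Adj a b →
        ¬ (G ⊔ SimpleGraph.fromEdgeSet {s(a, b)}).CliqueFree 4) ∧
      ∀ v : Fin n, ((G.neighborSet v).ncard : ℝ) ≤ 120 * √n := by
  let q := Nat.sqrt (n / 12)
  let c : Fin n → ZMod 12 := fun i => (i : ℕ)
  let x : Fin n → ℕ := fun i => (i : ℕ) / 12 % q
  let y : Fin n → ℕ := fun i => (i : ℕ) / (12 * q) % q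
  obtain ⟨G, hle, hG, hmax⟩ :=
    exists_maximal_cliqueFree_ge (gridGraph_cliqueFree (c := c) (x := x) (y := y))
  refine ⟨G, hG, hmax, fun v => ?_⟩
  rcases lt_or_ge n 12 with hn | hn
  · have h1 : (G.neighborSet v).ncard ≤ n := by
      simpa using Set.ncard_le_card (G.neighborSet v)
    have h2 : (1 : ℝ) ≤ √n := Real.one_le_sqrt.2 (by exact_mod_cast v.pos)
    have h3 : ((G.neighborSet v).ncard : ℝ) ≤ 12 := by exact_mod_cast h1.trans hn.le
    linarith
  have hq : 0 < q := Nat.sqrt_pos.2 (by omega)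
  have hq1 : q * q ≤ n / 12 := Nat.sqrt_le _
  have hq2 : n / 12 < (q + 1) * (q + 1) := Nat.lt_succ_sqrt _
  have hsurj : ∀ (g : ZMod 12) (u v : Fin n), ∃ w, c w = g ∧ x w = x u ∧ y w = y v := by
    intro g u v
    have hg : g.val < 12 := g.val_lt
    have hxu : x u < q := Nat.mod_lt _ hq
    have hyv : y v < q := Nat.mod_lt _ hq
    have hlt : g.val + 12 * (x u + q * y v) < n := by
      have : x u + q * y v < q * q := by nlinarith
      omega
    have hdiv : (g.val + 12 * (x u + q * y v)) / 12 = x u + q * y v := by omega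
    refine ⟨⟨_, hlt⟩, ?_, ?_, ?_⟩
    · have h12 : (12 : ZMod 12) = 0 := by decide
      simp [c, h12]
    · change (g.val + 12 * (x u + q * y v)) / 12 % q = x u
      rw [hdiv, Nat.add_mul_mod_self_left, Nat.mod_eq_of_lt hxu]
    · change (g.val + 12 * (x u + q * y v)) / (12 * q) % q = y v
      rw [← Nat.div_div_eq_div_mul, hdiv, Nat.add_mul_div_left _ _ hq, Nat.div_eq_of_lt hxu,
        zero_add, Nat.mod_eq_of_lt hyv]
  have hsub : G.neighborSet v ⊆ ↑((Finset.univ.filter fun i : Fin n => x i = x v) ∪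
      Finset.univ.filter fun i : Fin n => y i = y v) := by
    intro u hu
    simpa using eq_or_eq_of_adj_of_gridGraph_le hsurj hle hG hu.symm
  have hcard := (Set.ncard_le_ncard hsub (Finset.finite_toSet _)).trans
    ((Set.ncard_coe_finset _).le.trans (Finset.card_union_le _ _))
  have hX := card_filter_div_mod_eq_le n 12 q (x v) (by norm_num)
  have hY := card_filter_div_mod_eq_le n (12 * q) q (y v) (by positivity)
  have hn4 : n / 12 < 4 * (q * q) := by nlinarith
  have hX' : n / (12 * q) < 4 * q := by
    rw [← Nat.div_div_eq_div_mul, Nat.div_lt_iff_lt_mul hq]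
    linarith
  have hY' : n / (12 * q * q) < 4 := by
    rw [mul_assoc, ← Nat.div_div_eq_div_mul, Nat.div_lt_iff_lt_mul (by positivity)]
    exact hn4
  have hdeg : (G.neighborSet v).ncard ≤ 120 * q := by
    have h2 : 12 * q * (n / (12 * q * q) + 1) ≤ 12 * q * 4 := Nat.mul_le_mul_left _ hY'
    change (Finset.univ.filter fun i : Fin n => x i = x v).card ≤ _ at hX
    change (Finset.univ.filter fun i : Fin n => y i = y v).card ≤ _ at hY
    omega
  have hqn : (q : ℝ) ≤ √n := by
    refine Real.le_sqrt_of_sq_le ?_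
    rw [sq]
    exact_mod_cast hq1.trans (Nat.div_le_self _ _)
  have : ((G.neighborSet v).ncard : ℝ) ≤ 120 * q := by exact_mod_cast hdeg
  linarith

/-- There is a constant `C > 0` such that for every `n ≥ 2` there exists a maximal
`K₄`-free graph on `n` vertices whose maximum degree is at most
`C · n^(3/5) · (log n)^(1/5)`. -/
theorem exists_maximal_K4_free_small_max_degree :
    ∃ C : ℝ, 0 < C ∧ ∀ n : ℕ, 2 ≤ n →
      ∃ G : SimpleGraph (Fin n),
        G.CliqueFree 4 ∧
        (∀ a b : Fin n, a ≠ b → ¬ G.Adj a b →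
          ¬ (G ⊔ SimpleGraph.fromEdgeSet {s(a, b)}).CliqueFree 4) ∧
        ∀ v : Fin n,
          ((G.neighborSet v).ncard : ℝ) ≤ C * (n : ℝ) ^ ((3 : ℝ) / 5) * (Real.log n) ^ ((1 : ℝ) / 5) := by
  refine ⟨240, by norm_num, fun n hn => ?_⟩
  obtain ⟨G, hG, hmax, hdeg⟩ := exists_maximal_K4_free_le_sqrt n
  refine ⟨G, hG, hmax, fun v => (hdeg v).trans ?_⟩
  have hn' : (2 : ℝ) ≤ n := by exact_mod_cast hn
  have h1 : √(n : ℝ) ≤ (n : ℝ) ^ ((3 : ℝ) / 5) := by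
    rw [Real.sqrt_eq_rpow]
    exact Real.rpow_le_rpow_of_exponent_le (by linarith) (by norm_num)
  have hlog : 1 / 2 ≤ Real.log n := by
    have := Real.log_le_log (by norm_num) hn'
    have := Real.log_two_gt_d9
    linarith
  have h2 : (1 / 2 : ℝ) ≤ Real.log n ^ ((1 : ℝ) / 5) :=
    calc (1 / 2 : ℝ) = (1 / 2) ^ (1 : ℝ) := (Real.rpow_one _).symm
      _ ≤ (1 / 2) ^ ((1 : ℝ) / 5) :=
        Real.rpow_le_rpow_of_exponent_ge (by norm_num) (by norm_num) (by norm_num)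
      _ ≤ _ := Real.rpow_le_rpow (by norm_num) hlog (by norm_num)
  have h3 : √(n : ℝ) * (1 / 2) ≤ (n : ℝ) ^ ((3 : ℝ) / 5) * Real.log n ^ ((1 : ℝ) / 5) :=
    mul_le_mul h1 h2 (by norm_num) (by positivity)
  linarith
end

section
/- Let X be a finite set, F ⊆ X, let S be a finite family of subsets of X, let d be a natural number and m ≥ 0 a real number. Suppose that for every subfamily I ⊆ S with |I| ≤ d, the number of α ∈ S with α ⊆ F and α ∩ β = ∅ for every β ∈ I is at least m. Then for every integer r with 0 ≤ r ≤ d + 1, the number of r-tuples (α_1, …, α_r) ∈ S^r such that α_i ⊆ F for all i and α_i ∩ α_j = ∅ for all i ≠ j is at least m^r. -/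
/-- The members of `S` contained in `F` and disjoint from every member of `I`. -/
def disjointMembers {α : Type*} [DecidableEq α] (F : Finset α) (S I : Finset (Finset α)) :
    Finset (Finset α) :=
  S.filter fun A => A ⊆ F ∧ ∀ B ∈ I, Disjoint A B

/-- The `r`-tuples of pairwise disjoint members of `S` contained in `F`. -/
def disjointTuples {α : Type*} [DecidableEq α] (F : Finset α) (S : Finset (Finset α)) (r : ℕ) :
    Finset (Fin r → Finset α) :=
  (Fintype.piFinset fun _ => S).filter fun g =>
    (∀ i, g i ⊆ F) ∧ ∀ i j, i ≠ j → Disjoint (g i) (g j)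

theorem mem_disjointTuples {α : Type*} [DecidableEq α] {F : Finset α} {S : Finset (Finset α)}
    {r : ℕ} {g : Fin r → Finset α} :
    g ∈ disjointTuples F S r ↔
      (∀ i, g i ∈ S) ∧ (∀ i, g i ⊆ F) ∧ ∀ i j, i ≠ j → Disjoint (g i) (g j) := by
  simp [disjointTuples]

/-- Prepending to a disjoint tuple a member of `S` inside `F` that is disjoint from all its
entries gives a disjoint tuple. -/
theorem sum_card_extensions_le_card_disjointTuples {α : Type*} [DecidableEq α] (F : Finset α)
    (S : Finset (Finset α)) (r : ℕ) :
    ∑ g ∈ disjointTuples F S r,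
        (disjointMembers F S (Finset.univ.image g)).card ≤
      (disjointTuples F S (r + 1)).card := by
  rw [← Finset.card_sigma]
  refine Finset.card_le_card_of_injOn (fun p => Fin.cons p.2 p.1) ?_ ?_
  · rintro ⟨g, A⟩ hp
    simp only [Finset.coe_sigma, Set.mem_sigma_iff, Finset.mem_coe, mem_disjointTuples,
      disjointMembers, Finset.mem_filter, Finset.mem_image, Finset.mem_univ, true_and, forall_exists_index,
      forall_apply_eq_imp_iff] at hp ⊢
    obtain ⟨⟨hS, hF, hd⟩, hAS, hAF, hA⟩ := hp
    refine ⟨Fin.cases hAS hS, Fin.cases hAF hF, fun i j => ?_⟩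
    cases i using Fin.cases with
    | zero =>
      cases j using Fin.cases with
      | zero => exact fun hij => absurd rfl hij
      | succ j => exact fun _ => hA j
    | succ i =>
      cases j using Fin.cases with
      | zero => exact fun _ => (hA i).symm
      | succ j => exact fun hij => hd i j fun e => hij (congrArg Fin.succ e)
  · rintro ⟨g, A⟩ - ⟨g', A'⟩ - hp
    obtain ⟨rfl, rfl⟩ := Fin.cons_inj.mp hp
    rfl

/-- If for every subfamily `I ⊆ S` with `|I| ≤ d` there are at least `m` members of `S`
contained in `F` and disjoint from every member of `I`, then for every `r ≤ d + 1` the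
number of `r`-tuples of pairwise disjoint members of `S` contained in `F` is at least `m^r`. -/
theorem disjoint_tuples_count_lower_bound
    {α : Type*} [DecidableEq α] (X F : Finset α) (hFX : F ⊆ X)
    (S : Finset (Finset α)) (hSX : ∀ A ∈ S, A ⊆ X)
    (d : ℕ) (m : ℝ) (hm : 0 ≤ m)
    (h : ∀ I ⊆ S, I.card ≤ d →
      m ≤ ((S.filter fun A => A ⊆ F ∧ ∀ B ∈ I, Disjoint A B).card : ℝ)) :
    ∀ r : ℕ, r ≤ d + 1 →
      m ^ r ≤ (({g : Fin r → Finset α |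
          (∀ i, g i ∈ S) ∧ (∀ i, g i ⊆ F) ∧
            ∀ i j, i ≠ j → Disjoint (g i) (g j)}).ncard : ℝ) := by
  intro r hr
  have hset : {g : Fin r → Finset α | (∀ i, g i ∈ S) ∧ (∀ i, g i ⊆ F) ∧
      ∀ i j, i ≠ j → Disjoint (g i) (g j)} = ↑(disjointTuples F S r) :=
    Set.ext fun _ => mem_disjointTuples.symm
  rw [hset, Set.ncard_coe_finset]
  clear hset
  induction r with
  | zero => simp [disjointTuples]
  | succ r ih =>
    calc m ^ (r + 1) = m ^ r * m := pow_succ m r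
      _ ≤ ((disjointTuples F S r).card : ℝ) * m := by gcongr; exact ih (by omega)
      _ = ∑ _g ∈ disjointTuples F S r, m := by rw [Finset.sum_const, nsmul_eq_mul]
      _ ≤ ∑ g ∈ disjointTuples F S r,
          ((disjointMembers F S (Finset.univ.image g)).card : ℝ) := by
        refine Finset.sum_le_sum fun g hg => h _ ?_ ?_
        · exact Finset.image_subset_iff.mpr fun i _ => (mem_disjointTuples.mp hg).1 i
        · exact Finset.card_image_le.trans (by rw [Finset.card_fin]; omega)
      _ ≤ ((disjointTuples F S (r + 1)).card : ℝ) := by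
        exact_mod_cast sum_card_extensions_le_card_disjointTuples F S r
end

section
/- Let n ≥ 1 be an integer, let G be a simple graph on the vertex set {1, …, n}, and let ε, p > 0 be reals. For vertex sets A, B, let e(A,B) denote the number of edges of G with one endpoint in A and the other in B, where an edge with both endpoints in A ∩ B is counted once. Suppose that for all nonempty A, B ⊆ {1, …, n} with |A| = a and |B| = b we have e(A,B) < max{4·ε⁻¹·(a+b), p·a·b·n^(2ε)}. Then for every nonempty A ⊆ {1, …, n} with |A| = a and every real d ≥ max{16·ε⁻¹, 2·a·p·n^(2ε)}, the number of vertices of G having at least d neighbours in A is strictly less than 16·ε⁻¹·d⁻¹·a. -/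
open Classical in
/-- Each edge between `A` and `B` is counted at most twice when summing the number of
neighbours in `A` over the vertices of `B`. -/
theorem SimpleGraph.sum_ncard_neighborSet_inter_le {V : Type*} [Fintype V]
    (G : SimpleGraph V) (A B : Finset V) :
    ∑ v ∈ B, (G.neighborSet v ∩ ↑A).ncard ≤
      2 * {e ∈ G.edgeSet | ∃ a ∈ A, ∃ b ∈ B, e = s(a, b)}.ncard := by
  set T : Finset (V × V) := {x ∈ B ×ˢ A | G.Adj x.1 x.2} with hT
  have hsum : ∑ v ∈ B, (G.neighborSet v ∩ ↑A).ncard = T.card := by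
    rw [hT, Finset.card_filter, Finset.sum_product]
    refine Finset.sum_congr rfl fun v _ => ?_
    rw [← Finset.card_filter, ← Set.ncard_coe_finset]
    congr 1
    ext w
    simp [and_comm]
  have himage : (T.image fun x => s(x.1, x.2)).card ≤
      {e ∈ G.edgeSet | ∃ a ∈ A, ∃ b ∈ B, e = s(a, b)}.ncard := by
    rw [← Set.ncard_coe_finset]
    refine Set.ncard_le_ncard ?_ (Set.toFinite _)
    intro e he
    simp only [Finset.mem_coe, Finset.mem_image] at he
    obtain ⟨⟨b, a⟩, hx, rfl⟩ := he
    simp only [hT, Finset.mem_filter, Finset.mem_product] at hx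
    exact ⟨hx.2, a, hx.1.2, b, hx.1.1, Sym2.eq_swap⟩
  rw [hsum]
  refine (Finset.card_le_mul_card_image T 2 fun e _ => ?_).trans
    (Nat.mul_le_mul_left 2 himage)
  induction e using Sym2.ind with
  | _ x y =>
    refine (Finset.card_le_card (t := {(x, y), (y, x)}) fun z hz => ?_).trans
      Finset.card_le_two
    have h := (Finset.mem_filter.mp hz).2
    rw [Sym2.eq_iff] at h
    simpa [Prod.ext_iff] using h


/-- If in a graph `G` on `{1,…,n}` every pair of nonempty vertex sets `A, B` spans fewer
than `max{4ε⁻¹(|A|+|B|), p|A||B|n^(2ε)}` edges, then for every nonempty `A` and every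
`d ≥ max{16ε⁻¹, 2|A|pn^(2ε)}`, fewer than `16ε⁻¹d⁻¹|A|` vertices have at least `d`
neighbours in `A`. -/
theorem few_vertices_with_many_neighbours
    (n : ℕ) (hn : 1 ≤ n) (G : SimpleGraph (Fin n))
    (ε p : ℝ) (hε : 0 < ε) (hp : 0 < p)
    (hD : ∀ A B : Finset (Fin n), A.Nonempty → B.Nonempty →
      (({e ∈ G.edgeSet | ∃ a ∈ A, ∃ b ∈ B, e = s(a, b)}).ncard : ℝ) <
        max (4 * ε⁻¹ * ((A.card : ℝ) + (B.card : ℝ)))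
          (p * (A.card : ℝ) * (B.card : ℝ) * (n : ℝ) ^ (2 * ε))) :
    ∀ A : Finset (Fin n), A.Nonempty → ∀ d : ℝ,
      max (16 * ε⁻¹) (2 * (A.card : ℝ) * p * (n : ℝ) ^ (2 * ε)) ≤ d →
      (({v : Fin n | d ≤ ((G.neighborSet v ∩ ↑A).ncard : ℝ)}).ncard : ℝ) <
        16 * ε⁻¹ * d⁻¹ * (A.card : ℝ) := by
  classical
  intro A hA d hd
  obtain ⟨hd₁, hd₂⟩ := max_le_iff.mp hd
  have hε' : 0 < ε⁻¹ := inv_pos.mpr hε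
  have hd₀ : 0 < d := by linarith
  have hA₀ : (0 : ℝ) < A.card := by exact_mod_cast hA.card_pos
  set B : Finset (Fin n) := {v | d ≤ ((G.neighborSet v ∩ ↑A).ncard : ℝ)} with hB
  have hcard : {v : Fin n | d ≤ ((G.neighborSet v ∩ ↑A).ncard : ℝ)}.ncard = B.card := by
    rw [← Set.ncard_coe_finset]
    congr 1
    ext v
    simp [hB]
  rw [hcard]
  by_contra! hle
  have hB₀ : (0 : ℝ) < B.card := lt_of_lt_of_le (by positivity) hle
  have hlow : B.card * d ≤
      2 * ({e ∈ G.edgeSet | ∃ a ∈ A, ∃ b ∈ B, e = s(a, b)}.ncard : ℝ) := by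
    calc
      B.card * d ≤ ∑ v ∈ B, ((G.neighborSet v ∩ ↑A).ncard : ℝ) := by
        rw [← nsmul_eq_mul]
        exact Finset.card_nsmul_le_sum _ _ _ fun v hv => (Finset.mem_filter.mp hv).2
      _ ≤ _ := by exact_mod_cast G.sum_ncard_neighborSet_inter_le A B
  have hle' : 16 * ε⁻¹ * A.card ≤ B.card * d := by
    calc
      16 * ε⁻¹ * A.card = 16 * ε⁻¹ * d⁻¹ * A.card * d := by field_simp
      _ ≤ B.card * d := by gcongr
  have h₁ := mul_le_mul_of_nonneg_left hd₁ hB₀.le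
  have h₂ := mul_le_mul_of_nonneg_left hd₂ hB₀.le
  rcases lt_max_iff.mp (hD A B hA (Finset.card_pos.mp (by exact_mod_cast hB₀))) with h | h
  · linarith
  · linarith
end

section
/- Let (𝒜_i)_{i≥0} be a filtration on a probability space and let (X_i)_{i≥0} be a supermartingale with respect to (𝒜_i) with X_0 = 0 almost surely. Suppose there are real numbers M, N with 0 < M ≤ N/10 such that −M ≤ X_{i+1} − X_i ≤ N almost surely for every i ≥ 0. Then for every integer m ≥ 1 and every real a with 0 < a < m·M, we have P[X_m ≥ a] ≤ exp(−a²/(3·m·M·N)). -/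
open MeasureTheory

/-- On `[-M, N]` the exponential lies below its chord. -/
theorem exp_mul_le_chord {M N t x : ℝ} (hMN : 0 < M + N) (hx : -M ≤ x) (hx' : x ≤ N) :
    Real.exp (t * x) ≤ (M * Real.exp (t * N) + N * Real.exp (-(t * M))) / (M + N)
      + (Real.exp (t * N) - Real.exp (-(t * M))) / (M + N) * x := by
  have h := convexOn_exp.2 (Set.mem_univ (-(t * M))) (Set.mem_univ (t * N))
    (div_nonneg (sub_nonneg.2 hx') hMN.le)
    (div_nonneg (show 0 ≤ x + M by linarith) hMN.le)
    (by field_simp; ring)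
  simp only [smul_eq_mul] at h
  have e : (N - x) / (M + N) * -(t * M) + (x + M) / (M + N) * (t * N) = t * x := by
    field_simp; ring
  rw [e] at h
  refine h.trans (le_of_eq ?_)
  field_simp; ring

/-- Bound on the moment generating function of the centred law on `{-M, N}`. -/
theorem two_point_mgf_le {M N t : ℝ} (hM : 0 < M) (hMN : M ≤ N / 10) (ht : 0 ≤ t)
    (htN : t * N ≤ 2 / 3) :
    (M * Real.exp (t * N) + N * Real.exp (-(t * M))) / (M + N)
      ≤ Real.exp (3 / 4 * (t ^ 2 * M * N)) := by
  have hN : 0 < N := by linarith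
  have htN0 : 0 ≤ t * N := by positivity
  have htM0 : 0 ≤ t * M := by positivity
  have htM : t * M ≤ 1 := by nlinarith
  have h1 : Real.exp (t * N) ≤ 1 + t * N + 2 / 3 * (t * N) ^ 2 := by
    have h := Real.exp_bound' htN0 (by linarith) (n := 3) (by norm_num)
    norm_num [Finset.sum_range_succ, Nat.factorial] at h
    nlinarith [mul_nonneg (sq_nonneg (t * N)) (sub_nonneg.2 htN)]
  have h2 : Real.exp (-(t * M)) ≤ 1 - t * M + (t * M) ^ 2 := by
    have h := (abs_le.1 (Real.abs_exp_sub_one_sub_id_le (x := -(t * M))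
      (by rwa [abs_neg, abs_of_nonneg htM0]))).2
    linarith [neg_sq (t * M)]
  have h3 := Real.add_one_le_exp (3 / 4 * (t ^ 2 * M * N))
  refine le_trans ?_ h3
  rw [div_le_iff₀ (by linarith)]
  have h4 := mul_le_mul_of_nonneg_left h1 hM.le
  have h5 := mul_le_mul_of_nonneg_left h2 hN.le
  have h6 : 0 ≤ t ^ 2 * M * N * (N / 10 - M) :=
    mul_nonneg (by positivity) (by linarith)
  have h7 : 0 ≤ t ^ 2 * M * N * N := by positivity
  linarith

section

variable {Ω : Type*} {m0 : MeasurableSpace Ω} {μ : Measure Ω}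
  {𝒜 : Filtration ℕ m0} {X : ℕ → Ω → ℝ} {M N : ℝ}

theorem ae_abs_le_of_bounded_increments (hX0 : ∀ᵐ ω ∂μ, X 0 ω = 0)
    (hbdd : ∀ i : ℕ, ∀ᵐ ω ∂μ, -M ≤ X (i + 1) ω - X i ω ∧ X (i + 1) ω - X i ω ≤ N) (i : ℕ) :
    ∀ᵐ ω ∂μ, -(i * M) ≤ X i ω ∧ X i ω ≤ i * N := by
  induction i with
  | zero => filter_upwards [hX0] with ω h; simp [h]
  | succ i ih =>
    filter_upwards [ih, hbdd i] with ω h h'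
    push_cast
    constructor <;> linarith [h.1, h.2, h'.1, h'.2]

theorem ae_norm_exp_mul_le (hX0 : ∀ᵐ ω ∂μ, X 0 ω = 0)
    (hbdd : ∀ i : ℕ, ∀ᵐ ω ∂μ, -M ≤ X (i + 1) ω - X i ω ∧ X (i + 1) ω - X i ω ≤ N)
    {t : ℝ} (ht : 0 ≤ t) (i : ℕ) :
    ∀ᵐ ω ∂μ, ‖Real.exp (t * X i ω)‖ ≤ Real.exp (t * (i * N)) := by
  filter_upwards [ae_abs_le_of_bounded_increments hX0 hbdd i] with ω h
  rw [Real.norm_eq_abs, Real.abs_exp]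
  exact Real.exp_le_exp.2 (mul_le_mul_of_nonneg_left h.2 ht)

theorem stronglyMeasurable_exp_mul (hX : Supermartingale X 𝒜 μ) (t : ℝ) (i : ℕ) :
    StronglyMeasurable[𝒜 i] fun ω ↦ Real.exp (t * X i ω) :=
  Real.continuous_exp.comp_stronglyMeasurable ((hX.1 i).const_mul t)

theorem integrable_exp_mul_of_bounded_increments [IsFiniteMeasure μ]
    (hX : Supermartingale X 𝒜 μ)
    (hX0 : ∀ᵐ ω ∂μ, X 0 ω = 0)
    (hbdd : ∀ i : ℕ, ∀ᵐ ω ∂μ, -M ≤ X (i + 1) ω - X i ω ∧ X (i + 1) ω - X i ω ≤ N)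
    {t : ℝ} (ht : 0 ≤ t) (i : ℕ) :
    Integrable (fun ω ↦ Real.exp (t * X i ω)) μ :=
  .of_bound ((stronglyMeasurable_exp_mul hX t i).mono (𝒜.le i)).aestronglyMeasurable _
    (ae_norm_exp_mul_le hX0 hbdd ht i)

/-- A nonnegative bounded predictable weight against a supermartingale increment has nonpositive
expectation. -/
theorem integral_mul_increment_nonpos [IsFiniteMeasure μ]
    (hX : Supermartingale X 𝒜 μ) {i : ℕ} {Z : Ω → ℝ}
    (hZ : StronglyMeasurable[𝒜 i] Z) (hZ0 : 0 ≤ Z)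
    (hint : Integrable (fun ω ↦ Z ω * (X (i + 1) ω - X i ω)) μ) :
    ∫ ω, Z ω * (X (i + 1) ω - X i ω) ∂μ ≤ 0 := by
  have hD : Integrable (X (i + 1) - X i) μ := (hX.integrable _).sub (hX.integrable _)
  have hpull : μ[Z * (X (i + 1) - X i) | 𝒜 i] =ᵐ[μ] Z * μ[X (i + 1) - X i | 𝒜 i] :=
    condExp_mul_of_stronglyMeasurable_left hZ hint hD
  rw [← integral_condExp (𝒜.le i)]
  refine integral_nonpos_of_ae ?_
  have hself : μ[X i | 𝒜 i] = X i :=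
    condExp_of_stronglyMeasurable (𝒜.le i) (hX.1 i) (hX.integrable i)
  filter_upwards [hpull, condExp_sub (hX.integrable (i + 1)) (hX.integrable i) (𝒜 i),
    hX.2.1 i (i + 1) i.le_succ] with ω h1 h2 h3
  refine h1.trans_le (mul_nonpos_of_nonneg_of_nonpos (hZ0 ω) ?_)
  rw [h2, Pi.sub_apply, hself]
  exact sub_nonpos.2 h3

theorem integral_exp_mul_le_pow [IsProbabilityMeasure μ]
    (hX : Supermartingale X 𝒜 μ) (hX0 : ∀ᵐ ω ∂μ, X 0 ω = 0)
    (hM : 0 ≤ M) (hN : 0 < N)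
    (hbdd : ∀ i : ℕ, ∀ᵐ ω ∂μ, -M ≤ X (i + 1) ω - X i ω ∧ X (i + 1) ω - X i ω ≤ N)
    {t : ℝ} (ht : 0 ≤ t) (i : ℕ) :
    ∫ ω, Real.exp (t * X i ω) ∂μ
      ≤ ((M * Real.exp (t * N) + N * Real.exp (-(t * M))) / (M + N)) ^ i := by
  induction i with
  | zero =>
    have h : (fun ω ↦ Real.exp (t * X 0 ω)) =ᵐ[μ] fun _ ↦ 1 := by
      filter_upwards [hX0] with ω h
      simp [h]
    simp [integral_congr_ae h]
  | succ i ih =>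
    set A := (M * Real.exp (t * N) + N * Real.exp (-(t * M))) / (M + N) with hA
    set B := (Real.exp (t * N) - Real.exp (-(t * M))) / (M + N) with hB
    have hA0 : 0 ≤ A := by positivity
    have hB0 : 0 ≤ B := by
      refine div_nonneg (sub_nonneg.2 (Real.exp_le_exp.2 ?_)) (by linarith)
      nlinarith [mul_nonneg ht hM, mul_nonneg ht hN.le]
    have hZ := stronglyMeasurable_exp_mul hX t i
    have hZint := integrable_exp_mul_of_bounded_increments hX hX0 hbdd ht i
    have hZD : Integrable (fun ω ↦ Real.exp (t * X i ω) * (X (i + 1) ω - X i ω)) μ :=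
      ((hX.integrable _).sub (hX.integrable _)).bdd_mul
        (hZ.mono (𝒜.le i)).aestronglyMeasurable (ae_norm_exp_mul_le hX0 hbdd ht i)
    have hneg := integral_mul_increment_nonpos hX hZ (fun ω ↦ (Real.exp_pos _).le) hZD
    calc ∫ ω, Real.exp (t * X (i + 1) ω) ∂μ
        ≤ ∫ ω, (A * Real.exp (t * X i ω)
            + B * (Real.exp (t * X i ω) * (X (i + 1) ω - X i ω))) ∂μ := by
          refine integral_mono_ae
            (integrable_exp_mul_of_bounded_increments hX hX0 hbdd ht (i + 1))
            ((hZint.const_mul A).add (hZD.const_mul B)) ?_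
          filter_upwards [hbdd i] with ω h
          have hc := mul_le_mul_of_nonneg_left
            (exp_mul_le_chord (t := t) (by linarith) h.1 h.2) (Real.exp_pos (t * X i ω)).le
          rw [← Real.exp_add, ← mul_add, add_sub_cancel, ← hA, ← hB] at hc
          exact hc.trans_eq (by ring)
      _ = A * ∫ ω, Real.exp (t * X i ω) ∂μ
            + B * ∫ ω, Real.exp (t * X i ω) * (X (i + 1) ω - X i ω) ∂μ := by
          rw [integral_add (hZint.const_mul A) (hZD.const_mul B), integral_const_mul,
            integral_const_mul]
      _ ≤ A * A ^ i + 0 :=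
          add_le_add (mul_le_mul_of_nonneg_left ih hA0)
            (mul_nonpos_of_nonneg_of_nonpos hB0 hneg)
      _ = A ^ (i + 1) := by rw [add_zero, pow_succ']

end

/-- Hoeffding-type upper-tail bound for `(M,N)`-bounded supermartingales starting at `0`:
if `0 < M ≤ N/10` then for `m ≥ 1` and `0 < a < m·M` we have
`P[X_m ≥ a] ≤ exp(−a²/(3·m·M·N))`. -/
theorem supermartingale_upper_tail
    {Ω : Type*} {m0 : MeasurableSpace Ω} {μ : Measure Ω} [IsProbabilityMeasure μ]
    (𝒜 : Filtration ℕ m0) (X : ℕ → Ω → ℝ)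
    (hX : Supermartingale X 𝒜 μ) (hX0 : ∀ᵐ ω ∂μ, X 0 ω = 0)
    (M N : ℝ) (hM : 0 < M) (hMN : M ≤ N / 10)
    (hbdd : ∀ i : ℕ, ∀ᵐ ω ∂μ,
      -M ≤ X (i + 1) ω - X i ω ∧ X (i + 1) ω - X i ω ≤ N)
    (m : ℕ) (hm : 1 ≤ m) (a : ℝ) (ha : 0 < a) (ham : a < m * M) :
    (μ {ω | a ≤ X m ω}).toReal ≤ Real.exp (-a ^ 2 / (3 * m * M * N)) := by
  have hN : 0 < N := by linarith
  have hm0 : (0 : ℝ) < m := by exact_mod_cast hm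
  set t : ℝ := 2 * a / (3 * m * M * N) with ht_def
  have ht : 0 ≤ t := by positivity
  have htN : t * N ≤ 2 / 3 := by
    have e : t * N = 2 / 3 * (a / (m * M)) := by rw [ht_def]; field_simp
    have : a / (m * M) ≤ 1 := (div_le_one (by positivity)).2 ham.le
    linarith
  calc (μ {ω | a ≤ X m ω}).toReal
      ≤ Real.exp (-t * a) * ∫ ω, Real.exp (t * X m ω) ∂μ :=
        ProbabilityTheory.measure_ge_le_exp_mul_mgf a ht
          (integrable_exp_mul_of_bounded_increments hX hX0 hbdd ht m)
    _ ≤ Real.exp (-t * a) * Real.exp (3 / 4 * (t ^ 2 * M * N)) ^ m := by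
        gcongr
        exact (integral_exp_mul_le_pow hX hX0 hM.le hN hbdd ht m).trans
          (pow_le_pow_left₀ (by positivity) (two_point_mgf_le hM hMN ht htN) m)
    _ = Real.exp (-a ^ 2 / (3 * m * M * N)) := by
        rw [← Real.exp_nat_mul, ← Real.exp_add, ht_def]
        congr 1
        field_simp
        ring
end

section
/- Let (𝒜_i)_{i≥0} be a filtration on a probability space and let (X_i)_{i≥0} be a submartingale with respect to (𝒜_i) with X_0 = 0 almost surely. Suppose there are real numbers M, N with 0 < M ≤ N/2 such that −M ≤ X_{i+1} − X_i ≤ N almost surely for every i ≥ 0. Then for every integer m ≥ 1 and every real a with 0 < a < m·M, we have P[X_m ≤ −a] ≤ exp(−a²/(3·m·M·N)). -/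
open MeasureTheory

/-- Quadratic upper bound for the exponential near `0`, applied to a variable in `[-M, N]`
and linearised using `(d + M) * (N - d) ≥ 0`. -/
lemma exp_neg_mul_le_of_mem_Icc {M N t d : ℝ} (hMN : M ≤ N) (ht : 0 ≤ t)
    (htN : t * N ≤ 1) (hd : -M ≤ d) (hd' : d ≤ N) :
    Real.exp (-t * d) ≤
      (1 + 3 / 4 * (M * N * t ^ 2)) - (t - 3 / 4 * t ^ 2 * (N - M)) * d := by
  have habs : |-t * d| ≤ 1 := by
    rw [abs_le]
    constructor <;> nlinarith
  have h := (abs_le.mp (Real.exp_bound habs (n := 2) (by norm_num))).2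
  rw [sq_abs] at h
  norm_num [Finset.sum_range_succ] at h
  rw [← neg_mul] at h
  nlinarith [mul_nonneg (sq_nonneg t) (mul_nonneg (neg_le_iff_add_nonneg.mp hd)
    (sub_nonneg.mpr hd'))]

/-- A process starting at `0` with increments in `[-M, N]` lies in `[-nM, nN]` at time `n`. -/
lemma ae_mem_Icc_of_increments {Ω : Type*} {m0 : MeasurableSpace Ω} {μ : Measure Ω}
    {X : ℕ → Ω → ℝ} (hX0 : ∀ᵐ ω ∂μ, X 0 ω = 0) {M N : ℝ}
    (hbdd : ∀ i : ℕ, ∀ᵐ ω ∂μ,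
      -M ≤ X (i + 1) ω - X i ω ∧ X (i + 1) ω - X i ω ≤ N) (n : ℕ) :
    ∀ᵐ ω ∂μ, -(n * M) ≤ X n ω ∧ X n ω ≤ n * N := by
  induction n with
  | zero => filter_upwards [hX0] with ω h; simp [h]
  | succ n ih =>
    filter_upwards [ih, hbdd n] with ω h1 h2
    push_cast
    constructor <;> linarith [h1.1, h1.2, h2.1, h2.2]

/-- A submartingale increment has nonnegative integral against nonnegative weights
measurable with respect to the past. -/
lemma MeasureTheory.Submartingale.integral_mul_increment_nonneg {Ω : Type*}
    {m0 : MeasurableSpace Ω} {μ : Measure Ω} [IsFiniteMeasure μ] {𝒜 : Filtration ℕ m0}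
    {X : ℕ → Ω → ℝ} (hX : Submartingale X 𝒜 μ) (n : ℕ) {Y : Ω → ℝ}
    (hY : StronglyMeasurable[𝒜 n] Y) (hY0 : 0 ≤ Y)
    (hint : Integrable (fun ω ↦ Y ω * (X (n + 1) ω - X n ω)) μ) :
    0 ≤ ∫ ω, Y ω * (X (n + 1) ω - X n ω) ∂μ := by
  have hD : Integrable (X (n + 1) - X n) μ := (hX.integrable _).sub (hX.integrable _)
  have hpull := condExp_mul_of_stronglyMeasurable_left hY
    (show Integrable (Y * (X (n + 1) - X n)) μ from hint) hD
  have hnn := hX.condExp_sub_nonneg (Nat.le_succ n)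
  rw [← integral_condExp (𝒜.le n)]
  refine integral_nonneg_of_ae ?_
  change 0 ≤ᵐ[μ] μ[Y * (X (n + 1) - X n)|𝒜 n]
  filter_upwards [hpull, hnn] with ω h1 h2
  rw [h1]
  exact mul_nonneg (hY0 ω) h2

/-- Exponential moments of negative order of a bounded-increment process are finite. -/
lemma integrable_exp_neg_mul_of_increments {Ω : Type*} {m0 : MeasurableSpace Ω}
    {μ : Measure Ω} [IsFiniteMeasure μ] {X : ℕ → Ω → ℝ}
    (hX0 : ∀ᵐ ω ∂μ, X 0 ω = 0) {M N : ℝ}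
    (hbdd : ∀ i : ℕ, ∀ᵐ ω ∂μ,
      -M ≤ X (i + 1) ω - X i ω ∧ X (i + 1) ω - X i ω ≤ N)
    {t : ℝ} (ht : 0 ≤ t) (n : ℕ) (hXn : AEStronglyMeasurable (X n) μ) :
    Integrable (fun ω ↦ Real.exp (-t * X n ω)) μ := by
  refine Integrable.of_bound
    (Real.continuous_exp.comp_aestronglyMeasurable (hXn.const_mul (-t)))
    (Real.exp (t * (n * M))) ?_
  filter_upwards [ae_mem_Icc_of_increments hX0 hbdd n] with ω h
  rw [Real.norm_eq_abs, Real.abs_exp]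
  exact Real.exp_le_exp.mpr (by nlinarith [h.1])

/-- Bound on the moment generating function of a bounded-increment submartingale. -/
lemma MeasureTheory.Submartingale.mgf_neg_le {Ω : Type*} {m0 : MeasurableSpace Ω}
    {μ : Measure Ω} [IsProbabilityMeasure μ] {𝒜 : Filtration ℕ m0} {X : ℕ → Ω → ℝ}
    (hX : Submartingale X 𝒜 μ) (hX0 : ∀ᵐ ω ∂μ, X 0 ω = 0) {M N : ℝ} (hM : 0 < M)
    (hMN : M ≤ N)
    (hbdd : ∀ i : ℕ, ∀ᵐ ω ∂μ,
      -M ≤ X (i + 1) ω - X i ω ∧ X (i + 1) ω - X i ω ≤ N)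
    {t : ℝ} (ht : 0 ≤ t) (htN : t * N ≤ 1) (n : ℕ) :
    ProbabilityTheory.mgf (X n) μ (-t) ≤ (1 + 3 / 4 * (M * N * t ^ 2)) ^ n := by
  have hint (k : ℕ) := integrable_exp_neg_mul_of_increments hX0 hbdd ht k
    (hX.integrable k).aestronglyMeasurable
  induction n with
  | zero =>
    have h : ∀ᵐ ω ∂μ, Real.exp (-t * X 0 ω) = 1 := by
      filter_upwards [hX0] with ω h
      simp [h]
    rw [ProbabilityTheory.mgf, integral_congr_ae h]
    simp
  | succ n ih =>
    set K := 1 + 3 / 4 * (M * N * t ^ 2) with hK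
    set c := t - 3 / 4 * t ^ 2 * (N - M) with hc
    have hN : 0 < N := hM.trans_le hMN
    have hK0 : 0 ≤ K := by positivity
    have hc0 : 0 ≤ c := by
      have : c = t * (1 - 3 / 4 * (t * N) + 3 / 4 * (t * M)) := by rw [hc]; ring
      rw [this]
      exact mul_nonneg ht (by nlinarith)
    have hD : Integrable (fun ω ↦ Real.exp (-t * X n ω) * (X (n + 1) ω - X n ω)) μ := by
      refine (hint n).mul_bdd (c := N)
        ((hX.integrable _).sub (hX.integrable _)).aestronglyMeasurable ?_
      filter_upwards [hbdd n] with ω h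
      rw [Real.norm_eq_abs, abs_le]
      constructor <;> linarith [h.1, h.2]
    have hY : StronglyMeasurable[𝒜 n] (fun ω ↦ Real.exp (-t * X n ω)) :=
      Real.continuous_exp.comp_stronglyMeasurable
        ((hX.stronglyMeasurable n).const_mul (-t))
    have hpos := hX.integral_mul_increment_nonneg n hY
      (fun _ ↦ (Real.exp_pos _).le) hD
    calc ProbabilityTheory.mgf (X (n + 1)) μ (-t)
        ≤ ∫ ω, (K * Real.exp (-t * X n ω)
            - c * (Real.exp (-t * X n ω) * (X (n + 1) ω - X n ω))) ∂μ := by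
          refine integral_mono_ae (hint _) (((hint n).const_mul K).sub (hD.const_mul c)) ?_
          filter_upwards [hbdd n] with ω h
          have h1 := mul_le_mul_of_nonneg_left
            (exp_neg_mul_le_of_mem_Icc hMN ht htN h.1 h.2)
            (Real.exp_pos (-t * X n ω)).le
          rw [← Real.exp_add, ← mul_add, add_sub_cancel] at h1
          refine h1.trans_eq ?_
          rw [hK, hc]
          ring
      _ = K * ProbabilityTheory.mgf (X n) μ (-t)
            - c * ∫ ω, Real.exp (-t * X n ω) * (X (n + 1) ω - X n ω) ∂μ := by
          rw [integral_sub ((hint n).const_mul K) (hD.const_mul c), integral_const_mul,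
            integral_const_mul]
          rfl
      _ ≤ K * ProbabilityTheory.mgf (X n) μ (-t) := sub_le_self _ (mul_nonneg hc0 hpos)
      _ ≤ K * K ^ n := mul_le_mul_of_nonneg_left ih hK0
      _ = K ^ (n + 1) := (pow_succ' K n).symm

/-- Hoeffding-type lower-tail bound for `(M,N)`-bounded submartingales starting at `0`:
if `0 < M ≤ N/2` then for `m ≥ 1` and `0 < a < m·M` we have
`P[X_m ≤ −a] ≤ exp(−a²/(3·m·M·N))`. -/
theorem submartingale_lower_tail
    {Ω : Type*} {m0 : MeasurableSpace Ω} {μ : Measure Ω} [IsProbabilityMeasure μ]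
    (𝒜 : Filtration ℕ m0) (X : ℕ → Ω → ℝ)
    (hX : Submartingale X 𝒜 μ) (hX0 : ∀ᵐ ω ∂μ, X 0 ω = 0)
    (M N : ℝ) (hM : 0 < M) (hMN : M ≤ N / 2)
    (hbdd : ∀ i : ℕ, ∀ᵐ ω ∂μ,
      -M ≤ X (i + 1) ω - X i ω ∧ X (i + 1) ω - X i ω ≤ N)
    (m : ℕ) (hm : 1 ≤ m) (a : ℝ) (ha : 0 < a) (ham : a < m * M) :
    (μ {ω | X m ω ≤ -a}).toReal ≤ Real.exp (-a ^ 2 / (3 * m * M * N)) := by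
  have hN : 0 < N := by linarith
  have hm0 : (0 : ℝ) < m := by exact_mod_cast hm
  set t : ℝ := 2 * a / (3 * m * M * N) with ht_def
  have ht : 0 ≤ t := by positivity
  have htN : t * N ≤ 1 := by
    have : t * N = 2 * a / (3 * (m * M)) := by rw [ht_def]; field_simp
    rw [this, div_le_one (by positivity)]
    linarith
  have hmgf := hX.mgf_neg_le hX0 hM (by linarith) hbdd ht htN m
  have hint := integrable_exp_neg_mul_of_increments hX0 hbdd ht m
    (hX.integrable m).aestronglyMeasurable
  calc (μ {ω | X m ω ≤ -a}).toReal
      ≤ Real.exp (-(-t) * -a) * ProbabilityTheory.mgf (X m) μ (-t) :=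
        ProbabilityTheory.measure_le_le_exp_mul_mgf (-a) (neg_nonpos.mpr ht) hint
    _ ≤ Real.exp (-(-t) * -a) * Real.exp (3 / 4 * (M * N * t ^ 2)) ^ m := by
        refine mul_le_mul_of_nonneg_left (hmgf.trans ?_) (Real.exp_pos _).le
        refine pow_le_pow_left₀ (by positivity) ?_ m
        rw [add_comm]
        exact Real.add_one_le_exp _
    _ = Real.exp (-a ^ 2 / (3 * m * M * N)) := by
        rw [← Real.exp_nat_mul, ← Real.exp_add, ht_def]
        congr 1
        field_simp
        ring
end
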